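/- arXiv:2203.06344 — 11 statements merged into one kernel-verified Lean document; each statement's English description precedes it below -/
import Mathlib

section
/- Let X be a T0 topological space. Then: (1) every directed-open subset of X is an upper set with respect to the specialization order; (2) the family d(O(X)) of directed-open sets is a topology on X, the space (X, d(O(X))) is T0, and its specialization order coincides with that of X; (3) for every directed subset D of X and every x ∈ X, D converges to x in X if and only if D converges to x in (X, d(O(X))); (4) d(d(O(X))) = d(O(X)), i.e., (X, d(O(X))) is a directed space. -/
open Set TopologicalSpace

universe u

variable {X : Type*}

/-- Specialization order: `x ⊑ y` iff `x ∈ cl {y}`. -/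
def specLE (t : TopologicalSpace X) (x y : X) : Prop := x ∈ @closure X t {y}

/-- `↑A` with respect to the specialization order. -/
def upSet (t : TopologicalSpace X) (A : Set X) : Set X := {z | ∃ a ∈ A, specLE t a z}

/-- `↓A` with respect to the specialization order. -/
def downSet (t : TopologicalSpace X) (A : Set X) : Set X := {z | ∃ a ∈ A, specLE t z a}

/-- A directed subset with respect to the specialization order. -/
def DirSet (t : TopologicalSpace X) (D : Set X) : Prop :=
  D.Nonempty ∧ ∀ a ∈ D, ∀ b ∈ D, ∃ c ∈ D, specLE t a c ∧ specLE t b c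

/-- `D → x`: every open set containing `x` meets `D`. -/
def DConv (t : TopologicalSpace X) (D : Set X) (x : X) : Prop :=
  ∀ U : Set X, t.IsOpen U → x ∈ U → (D ∩ U).Nonempty

/-- Directed-open subset. -/
def DirOpen (t : TopologicalSpace X) (U : Set X) : Prop :=
  ∀ D : Set X, DirSet t D → ∀ x ∈ U, DConv t D x → (D ∩ U).Nonempty

/-- A directed space: every directed-open set is open. -/
def DirSpace (t : TopologicalSpace X) : Prop :=
  ∀ U : Set X, DirOpen t U → t.IsOpen U

/-- `x ≪_d y`. -/
def dWay (t : TopologicalSpace X) (x y : X) : Prop :=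
  ∀ D : Set X, DirSet t D → DConv t D y → ∃ d ∈ D, specLE t x d

/-- c-space. -/
def CSpace (t : TopologicalSpace X) : Prop :=
  ∀ (x : X) (U : Set X), t.IsOpen U → x ∈ U → ∃ y ∈ U, x ∈ @interior X t (upSet t {y})

/-- b-space. -/
def BSpace (t : TopologicalSpace X) : Prop :=
  ∀ (x : X) (U : Set X), t.IsOpen U → x ∈ U →
    ∃ y ∈ U, t.IsOpen (upSet t {y}) ∧ x ∈ upSet t {y} ∧ upSet t {y} ⊆ U

/-- locally hypercompact space. -/
def LocallyHypercompact (t : TopologicalSpace X) : Prop :=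
  ∀ (U : Set X), t.IsOpen U → ∀ x ∈ U, ∃ F : Set X, F.Finite ∧
    x ∈ @interior X t (upSet t F) ∧ upSet t F ⊆ U

/-- `s` is the supremum of `A` with respect to the specialization order. -/
def IsSupOf (t : TopologicalSpace X) (A : Set X) (s : X) : Prop :=
  (∀ a ∈ A, specLE t a s) ∧ ∀ y : X, (∀ a ∈ A, specLE t a y) → specLE t s y

/-- Topological ideal: a directed lower set possessing a supremum to which it converges. -/
def TopIdeal (t : TopologicalSpace X) (A : Set X) : Prop :=
  DirSet t A ∧ downSet t A = A ∧ ∃ s : X, IsSupOf t A s ∧ DConv t A s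

/-- The set `I_T(X)` of topological ideals. -/
abbrev IT (t : TopologicalSpace X) := {A : Set X // TopIdeal t A}

/-- The family `Ω(I_T(X))`. -/
def OmegaOpen (t : TopologicalSpace X) (U : Set (IT t)) : Prop :=
  ∀ A : IT t, A ∈ U ↔ ∃ B ∈ U, (∃ x : X, B.1 = downSet t {x}) ∧ B.1 ⊆ A.1

/-- Way-below relation in a complete lattice. -/
def wayBelow {L : Type*} [CompleteLattice L] (a b : L) : Prop :=
  ∀ D : Set L, D.Nonempty → DirectedOn (· ≤ ·) D → b ≤ sSup D → ∃ d ∈ D, a ≤ d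

/-- Continuous (complete) lattice. -/
def ContinuousLattice (L : Type*) [CompleteLattice L] : Prop :=
  ∀ x : L, {a : L | wayBelow a x}.Nonempty ∧ DirectedOn (· ≤ ·) {a : L | wayBelow a x} ∧
    sSup {a : L | wayBelow a x} = x

/-- Completely distributive complete lattice. -/
def CompletelyDistrib (L : Type u) [CompleteLattice L] : Prop :=
  ∀ (ι : Type u) (κ : ι → Type u) (f : (i : ι) → κ i → L),
    (⨅ i, ⨆ j, f i j) = ⨆ g : (i : ι) → κ i, ⨅ i, f i (g i)

/-- `↑F` in a preordered set. -/
def upOf {L : Type*} [Preorder L] (F : Set L) : Set L := {z | ∃ f ∈ F, f ≤ z}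

/-- `F ≪ x` for a set `F` in a complete lattice. -/
def finWay {L : Type*} [CompleteLattice L] (F : Set L) (x : L) : Prop :=
  ∀ D : Set L, D.Nonempty → DirectedOn (· ≤ ·) D → x ≤ sSup D → ∃ d ∈ D, ∃ f ∈ F, f ≤ d

/-- Quasicontinuous complete lattice. -/
def QuasicontinuousLattice (L : Type*) [CompleteLattice L] : Prop :=
  ∀ x : L,
    (∀ F G : Set L, F.Finite → finWay F x → G.Finite → finWay G x →
      ∃ H : Set L, H.Finite ∧ finWay H x ∧ upOf H ⊆ upOf F ∧ upOf H ⊆ upOf G) ∧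
    Set.Ici x = ⋂₀ {S : Set L | ∃ F : Set L, F.Finite ∧ finWay F x ∧ S = upOf F}

/-- Algebraic complete lattice: every element is the sup of the compact elements below it. -/
def AlgebraicLattice (L : Type*) [CompleteLattice L] : Prop :=
  ∀ x : L, sSup {k : L | wayBelow k k ∧ k ≤ x} = x

/-- Scott-open subset of a preordered set. -/
def ScottOpen {L : Type*} [Preorder L] (U : Set L) : Prop :=
  IsUpperSet U ∧ ∀ D : Set L, D.Nonempty → DirectedOn (· ≤ ·) D →
    ∀ s : L, IsLUB D s → s ∈ U → (D ∩ U).Nonempty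

/-- The Scott topology. -/
def scottSp (L : Type*) [Preorder L] : TopologicalSpace L :=
  TopologicalSpace.generateFrom {U : Set L | ScottOpen U}

/-- The upper topology. -/
def upperSp (L : Type*) [Preorder L] : TopologicalSpace L :=
  TopologicalSpace.generateFrom {S : Set L | ∃ a : L, S = (Set.Iic a)ᶜ}

theorem specLE_iff_opens {X : Type*} (t : TopologicalSpace X) (x y : X) :
    specLE t x y ↔ ∀ U : Set X, t.IsOpen U → x ∈ U → y ∈ U := by
  unfold specLE
  rw [mem_closure_iff]
  constructor
  · intro h U hU hx
    obtain ⟨z, hz, rfl⟩ := h U hU hx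
    exact hz
  · intro h U hU hx
    exact ⟨y, h U hU hx, rfl⟩

theorem DirOpen.up {X : Type*} {t : TopologicalSpace X} {U : Set X} (hU : DirOpen t U)
    {x y : X} (hx : x ∈ U) (h : specLE t x y) : y ∈ U := by
  rw [specLE_iff_opens] at h
  have hyy : specLE t y y := (specLE_iff_opens t y y).2 fun _ _ h => h
  obtain ⟨z, hz, hzU⟩ := hU {y} ⟨⟨y, rfl⟩, by
    rintro a rfl b rfl
    exact ⟨_, rfl, hyy, hyy⟩⟩ x hx
    (fun V hV hxV => ⟨y, rfl, h V hV hxV⟩)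
  rw [mem_singleton_iff] at hz
  exact hz ▸ hzU

theorem DirOpen.of_open {X : Type*} {t : TopologicalSpace X} {U : Set X} (hU : t.IsOpen U) :
    DirOpen t U := fun _ _ x hx hc => hc U hU hx

/-- The topology of directed-open sets. -/
def dirTop {X : Type*} (t : TopologicalSpace X) : TopologicalSpace X where
  IsOpen := DirOpen t
  isOpen_univ := by
    intro D hD x _ _
    simpa using hD.1
  isOpen_inter := by
    intro U V hU hV D hD x hx hc
    obtain ⟨a, haD, haU⟩ := hU D hD x hx.1 hc
    obtain ⟨b, hbD, hbV⟩ := hV D hD x hx.2 hc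
    obtain ⟨c, hc, hac, hbc⟩ := hD.2 a haD b hbD
    exact ⟨c, hc, hU.up haU hac, hV.up hbV hbc⟩
  isOpen_sUnion := by
    intro S hS D hD x hx hc
    obtain ⟨U, hUS, hxU⟩ := hx
    obtain ⟨a, haD, haU⟩ := hS U hUS D hD x hxU hc
    exact ⟨a, haD, U, hUS, haU⟩

theorem specLE_dirTop {X : Type*} (t : TopologicalSpace X) (x y : X) :
    specLE (dirTop t) x y ↔ specLE t x y := by
  constructor
  · intro h
    rw [specLE_iff_opens] at h ⊢
    exact fun U hU => h U (DirOpen.of_open hU)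
  · intro h
    rw [specLE_iff_opens]
    exact fun U hU hx => DirOpen.up hU hx h

theorem DirSet_dirTop {X : Type*} (t : TopologicalSpace X) (D : Set X) :
    DirSet (dirTop t) D ↔ DirSet t D := by
  simp only [DirSet, specLE_dirTop]

theorem DConv_dirTop {X : Type*} (t : TopologicalSpace X) (D : Set X) (x : X)
    (hD : DirSet t D) : DConv t D x ↔ DConv (dirTop t) D x :=
  ⟨fun h U hU hx => hU D hD x hx h, fun h U hU hx => h U (DirOpen.of_open hU) hx⟩

theorem statement0 {X : Type*} [t : TopologicalSpace X] [T0Space X] :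
    (∀ U : Set X, DirOpen t U → ∀ x ∈ U, ∀ y : X, specLE t x y → y ∈ U) ∧
    ∃ t' : TopologicalSpace X,
      (∀ U : Set X, t'.IsOpen U ↔ DirOpen t U) ∧
      @T0Space X t' ∧
      (∀ x y : X, specLE t' x y ↔ specLE t x y) ∧
      (∀ (D : Set X) (x : X), DirSet t D → (DConv t D x ↔ DConv t' D x)) ∧
      (∀ U : Set X, DirOpen t' U ↔ t'.IsOpen U) := by
  refine ⟨fun U hU x hx y h => hU.up hx h, dirTop t, fun U => Iff.rfl, ?_,
    specLE_dirTop t, DConv_dirTop t, ?_⟩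
  · refine @T0Space.mk X (dirTop t) ?_
    intro x y h
    have h2 := (@inseparable_iff_forall_isOpen X (dirTop t) x y).1 h
    exact Inseparable.eq (inseparable_iff_forall_isOpen.2
      fun U hU => h2 U (DirOpen.of_open hU))
  · intro U
    refine ⟨fun h D hD x hx hc => ?_, DirOpen.of_open⟩
    exact h D ((DirSet_dirTop t D).2 hD) x hx ((DConv_dirTop t D x hD).1 hc)
end

section
/- Let X and Y be directed spaces. A subset U of X × Y is open in D(X × Y) (the space X × Y retopologized with the directed-open sets of the product topology) if and only if the following two conditions hold: (1) for every directed subset (x_i)_{i∈I} of X converging to x in X and every (x,y) ∈ U, there exists i ∈ I with (x_i, y) ∈ U; and (2) for every directed subset (y_i)_{i∈I} of Y converging to y in Y and every (x,y) ∈ U, there exists i ∈ I with (x, y_i) ∈ U. -/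
open Set TopologicalSpace

universe u

variable {X : Type*}

theorem specLE_prod_aux {X Y : Type*} [tX : TopologicalSpace X] [tY : TopologicalSpace Y]
    (a b : X × Y) : specLE (inferInstance : TopologicalSpace (X × Y)) a b ↔
      specLE tX a.1 b.1 ∧ specLE tY a.2 b.2 := by
  unfold specLE
  have h : ({b} : Set (X × Y)) = {b.1} ×ˢ {b.2} := by simp
  rw [h]
  exact (Set.ext_iff.1 closure_prod_eq a)

theorem specLE_refl_aux {X : Type*} (t : TopologicalSpace X) (a : X) : specLE t a a :=
  subset_closure (Set.mem_singleton a)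

theorem dirSet_single_aux {X : Type*} (t : TopologicalSpace X) (a : X) : DirSet t {a} := by
  refine ⟨⟨a, rfl⟩, ?_⟩
  rintro x rfl y rfl
  exact ⟨_, rfl, specLE_refl_aux t _, specLE_refl_aux t _⟩

theorem dConv_single_aux {X : Type*} (t : TopologicalSpace X) (a b : X) (h : specLE t a b) :
    DConv t {b} a := by
  intro V hV ha
  have := mem_closure_iff.1 h V hV ha
  rwa [Set.inter_comm] at this

theorem statement1 {X Y : Type*} [tX : TopologicalSpace X] [tY : TopologicalSpace Y]
    [T0Space X] [T0Space Y] (hX : DirSpace tX) (hY : DirSpace tY) (U : Set (X × Y)) :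
    DirOpen (inferInstance : TopologicalSpace (X × Y)) U ↔
      ((∀ D : Set X, DirSet tX D → ∀ x : X, DConv tX D x → ∀ y : Y, (x, y) ∈ U →
          ∃ d ∈ D, (d, y) ∈ U) ∧
       (∀ E : Set Y, DirSet tY E → ∀ y : Y, DConv tY E y → ∀ x : X, (x, y) ∈ U →
          ∃ e ∈ E, (x, e) ∈ U)) := by
  constructor
  · intro hU
    constructor
    · intro D hD x hx y hxy
      have h1 : DirSet (inferInstance : TopologicalSpace (X × Y)) ((fun d => (d, y)) '' D) := by
        refine ⟨hD.1.image _, ?_⟩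
        rintro _ ⟨a, ha, rfl⟩ _ ⟨b, hb, rfl⟩
        obtain ⟨c, hc, h1, h2⟩ := hD.2 a ha b hb
        exact ⟨_, ⟨c, hc, rfl⟩, (specLE_prod_aux _ _).2 ⟨h1, specLE_refl_aux _ _⟩,
          (specLE_prod_aux _ _).2 ⟨h2, specLE_refl_aux _ _⟩⟩
      obtain ⟨_, ⟨d, hd, rfl⟩, h⟩ := hU _ h1 (x, y) hxy (by
        intro V hV hm
        have hV' : IsOpen V := hV
        obtain ⟨d, hd, h⟩ := hx ((fun d => (d, y)) ⁻¹' V)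
          (hV'.preimage (by fun_prop)) hm
        exact ⟨_, ⟨d, hd, rfl⟩, h⟩)
      exact ⟨d, hd, h⟩
    · intro D hD y hy x hxy
      have h1 : DirSet (inferInstance : TopologicalSpace (X × Y)) ((fun d => (x, d)) '' D) := by
        refine ⟨hD.1.image _, ?_⟩
        rintro _ ⟨a, ha, rfl⟩ _ ⟨b, hb, rfl⟩
        obtain ⟨c, hc, h1, h2⟩ := hD.2 a ha b hb
        exact ⟨_, ⟨c, hc, rfl⟩, (specLE_prod_aux _ _).2 ⟨specLE_refl_aux _ _, h1⟩,
          (specLE_prod_aux _ _).2 ⟨specLE_refl_aux _ _, h2⟩⟩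
      obtain ⟨_, ⟨d, hd, rfl⟩, h⟩ := hU _ h1 (x, y) hxy (by
        intro V hV hm
        have hV' : IsOpen V := hV
        obtain ⟨d, hd, h⟩ := hy ((fun d => (x, d)) ⁻¹' V)
          (hV'.preimage (by fun_prop)) hm
        exact ⟨_, ⟨d, hd, rfl⟩, h⟩)
      exact ⟨d, hd, h⟩
  · rintro ⟨h1, h2⟩ D hD ⟨x, y⟩ hxy hconv
    have hD1 : DirSet tX (Prod.fst '' D) := by
      refine ⟨hD.1.image _, ?_⟩
      rintro _ ⟨a, ha, rfl⟩ _ ⟨b, hb, rfl⟩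
      obtain ⟨c, hc, h1, h2⟩ := hD.2 a ha b hb
      exact ⟨_, ⟨c, hc, rfl⟩, ((specLE_prod_aux _ _).1 h1).1, ((specLE_prod_aux _ _).1 h2).1⟩
    have hD2 : DirSet tY (Prod.snd '' D) := by
      refine ⟨hD.1.image _, ?_⟩
      rintro _ ⟨a, ha, rfl⟩ _ ⟨b, hb, rfl⟩
      obtain ⟨c, hc, h1, h2⟩ := hD.2 a ha b hb
      exact ⟨_, ⟨c, hc, rfl⟩, ((specLE_prod_aux _ _).1 h1).2, ((specLE_prod_aux _ _).1 h2).2⟩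
    have hC1 : DConv tX (Prod.fst '' D) x := by
      intro V hV hm
      have hV' : IsOpen V := hV
      obtain ⟨d, hd, h⟩ := hconv (Prod.fst ⁻¹' V) (hV'.preimage continuous_fst) hm
      exact ⟨_, ⟨d, hd, rfl⟩, h⟩
    have hC2 : DConv tY (Prod.snd '' D) y := by
      intro V hV hm
      have hV' : IsOpen V := hV
      obtain ⟨d, hd, h⟩ := hconv (Prod.snd ⁻¹' V) (hV'.preimage continuous_snd) hm
      exact ⟨_, ⟨d, hd, rfl⟩, h⟩
    obtain ⟨_, ⟨p, hp, rfl⟩, hpU⟩ := h1 _ hD1 x hC1 y hxy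
    obtain ⟨_, ⟨q, hq, rfl⟩, hqU⟩ := h2 _ hD2 y hC2 p.1 hpU
    obtain ⟨r, hr, hpr, hqr⟩ := hD.2 p hp q hq
    obtain ⟨_, rfl, h3⟩ := h1 {r.1} (dirSet_single_aux _ _) p.1
      (dConv_single_aux _ _ _ ((specLE_prod_aux _ _).1 hpr).1) q.2 hqU
    obtain ⟨_, rfl, h4⟩ := h2 {r.2} (dirSet_single_aux _ _) q.2
      (dConv_single_aux _ _ _ ((specLE_prod_aux _ _).1 hqr).2) r.1 h3
    exact ⟨r, hr, h4⟩
end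

section
/- Let X be a T0 topological space and D a directed subset of X. Then: (1) if D ⊆ ↓x and D converges to x for some x ∈ X, then x is the least upper bound of D with respect to the specialization order; (2) if D converges to x and the supremum sup D of D with respect to the specialization order exists, then x ⊑ sup D. -/
open Set TopologicalSpace

universe u

variable {X : Type*}

theorem statement2 {X : Type*} [t : TopologicalSpace X] [T0Space X]
    (D : Set X) (hD : DirSet t D) :
    (∀ x : X, (∀ d ∈ D, specLE t d x) → DConv t D x → IsSupOf t D x) ∧
    (∀ x s : X, DConv t D x → IsSupOf t D s → specLE t x s) := by
  have key : ∀ x y : X, DConv t D x → (∀ d ∈ D, specLE t d y) → specLE t x y := by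
    intro x y hx hy
    by_contra hn
    obtain ⟨d, hd, hdU⟩ := hx (closure {y})ᶜ isClosed_closure.isOpen_compl hn
    exact hdU (hy d hd)
  exact ⟨fun x hx hc => ⟨hx, fun y hy => key x y hc hy⟩, fun x s hc hs => key x s hc hs.1⟩
end

section
/- For every T0 topological space X, the map ⋁ : I_T(X) → X sending each topological ideal A to its supremum ⋁A is a continuous surjection from (I_T(X), Ω(I_T(X))) onto X. -/
open Set TopologicalSpace

universe u

variable {X : Type*}

theorem specLE_open {X : Type*} {t : TopologicalSpace X} {x y : X} (h : specLE t x y)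
    {U : Set X} (hU : t.IsOpen U) (hx : x ∈ U) : y ∈ U := by
  obtain ⟨z, hz, hz'⟩ := (@mem_closure_iff X t _ _).1 h U hU hx
  have e : z = y := hz'
  exact e ▸ hz

theorem specLE_rfl {X : Type*} (t : TopologicalSpace X) (x : X) : specLE t x x :=
  @subset_closure X t {x} x rfl

theorem specLE_tr {X : Type*} {t : TopologicalSpace X} {x y z : X} (h : specLE t x y)
    (h' : specLE t y z) : specLE t x z := by
  refine (@mem_closure_iff X t _ _).2 fun U hU hx => ?_
  exact ⟨z, specLE_open h' hU (specLE_open h hU hx), rfl⟩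

theorem isSupOf_down {X : Type*} (t : TopologicalSpace X) (x : X) :
    IsSupOf t (downSet t {x}) x := by
  refine ⟨?_, fun y hy => hy x ⟨x, rfl, specLE_rfl t x⟩⟩
  rintro a ⟨b, rfl, h⟩
  exact h

theorem topIdeal_down {X : Type*} (t : TopologicalSpace X) (x : X) :
    TopIdeal t (downSet t {x}) := by
  have hx : x ∈ downSet t {x} := ⟨x, rfl, specLE_rfl t x⟩
  refine ⟨⟨⟨x, hx⟩, fun a ha b hb =>
    ⟨x, hx, (isSupOf_down t x).1 a ha, (isSupOf_down t x).1 b hb⟩⟩, ?_, x, isSupOf_down t x,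
    fun U _ hxU => ⟨x, hx, hxU⟩⟩
  ext z
  constructor
  · rintro ⟨a, ha, hz⟩
    exact ⟨x, rfl, specLE_tr hz ((isSupOf_down t x).1 a ha)⟩
  · intro hz
    exact ⟨z, hz, specLE_rfl t z⟩

theorem statement5 {X : Type*} [t : TopologicalSpace X] [T0Space X]
    (tI : TopologicalSpace (IT t)) (htI : ∀ U : Set (IT t), tI.IsOpen U ↔ OmegaOpen t U)
    (v : IT t → X) (hv : ∀ A : IT t, IsSupOf t A.1 (v A)) :
    @Continuous (IT t) X tI t v ∧ Function.Surjective v := by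
  constructor
  · refine @Continuous.mk _ _ tI t v fun U hU => ?_
    refine (htI _).2 fun A => ⟨fun hA => ?_, ?_⟩
    · obtain ⟨_, hlow, s, hs, hconv⟩ := A.2
      have hsU : s ∈ U := specLE_open ((hv A).2 s hs.1) hU hA
      obtain ⟨a, haA, haU⟩ := hconv U hU hsU
      refine ⟨⟨downSet t {a}, topIdeal_down t a⟩, ?_, ⟨a, rfl⟩, ?_⟩
      · exact specLE_open ((hv ⟨downSet t {a}, topIdeal_down t a⟩).1 a
          ⟨a, rfl, specLE_rfl t a⟩) hU haU
      · rintro z ⟨b, rfl, hz⟩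
        rw [← hlow]
        exact ⟨b, haA, hz⟩
    · rintro ⟨B, hB, _, hBA⟩
      exact specLE_open ((hv B).2 (v A) fun a ha => (hv A).1 a (hBA ha)) hU hB
  · intro x
    refine ⟨⟨downSet t {x}, topIdeal_down t x⟩, ?_⟩
    have h := hv ⟨downSet t {x}, topIdeal_down t x⟩
    have h1 := h.2 x (isSupOf_down t x).1
    have h2 := (isSupOf_down t x).2 _ h.1
    refine Inseparable.eq (inseparable_iff_forall_isOpen.2 fun U hU => ?_)
    exact ⟨specLE_open h1 hU, specLE_open h2 hU⟩
end

section
/- Let X be a directed space and let K ⊆ X be a compact open subset. Then there exists a finite subset F ⊆ X such that K = ↑F. Consequently, for a directed space X, every compact element of the lattice of open sets O(X) is hypercompact, and O(X) is an algebraic lattice if and only if it is hyperalgebraic. -/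
open Set TopologicalSpace

universe u

variable {X : Type*}

theorem st8_up {X : Type*} [t : TopologicalSpace X] {U : Set X} (hU : IsOpen U) {x y : X}
    (h : specLE t x y) (hx : x ∈ U) : y ∈ U :=
  (specializes_iff_mem_closure.2 h).mem_open hU hx

theorem st8_antisymm {X : Type*} [t : TopologicalSpace X] [T0Space X] {x y : X}
    (h : specLE t x y) (h' : specLE t y x) : x = y :=
  ((specializes_iff_mem_closure.2 h').antisymm (specializes_iff_mem_closure.2 h)).eq

/-- Every point of a compact set lies above a minimal point. -/
theorem st8_min {X : Type*} [t : TopologicalSpace X] [T0Space X] {K : Set X} (hK : IsCompact K)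
    {x : X} (hx : x ∈ K) :
    ∃ m ∈ K, (∀ y ∈ K, specLE t y m → y = m) ∧ specLE t m x := by
  obtain ⟨C, hCx, hC⟩ := zorn_superset_nonempty {C : Set X | IsClosed C ∧ (K ∩ C).Nonempty}
    (by
      intro c hc hch hne
      have : Nonempty c := hne.to_subtype
      refine ⟨⋂₀ c, ⟨isClosed_sInter fun s hs => (hc hs).1, ?_⟩, fun s hs => sInter_subset_of_mem hs⟩
      by_contra hcon
      rw [not_nonempty_iff_eq_empty, sInter_eq_iInter] at hcon
      obtain ⟨i, hi⟩ := hK.elim_directed_family_closed (fun i : c => (i : Set X))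
        (fun i => (hc i.2).1) hcon (by
          intro i j
          rcases hch.total i.2 j.2 with h | h
          · exact ⟨i, Subset.rfl, h⟩
          · exact ⟨j, h, Subset.rfl⟩)
      exact (hc i.2).2.ne_empty hi)
    (closure {x}) ⟨isClosed_closure, x, hx, subset_closure rfl⟩
  obtain ⟨⟨hCc, m, hmK, hmC⟩, hmin⟩ := hC
  refine ⟨m, hmK, ?_, hCx hmC⟩
  intro y hy hym
  have hyC : y ∈ C := closure_minimal (singleton_subset_iff.2 hmC) hCc hym
  have h : C ⊆ closure {y} := hmin ⟨isClosed_closure, y, hy, subset_closure rfl⟩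
    (closure_minimal (singleton_subset_iff.2 hyC) hCc)
  exact st8_antisymm hym (h hmC)

theorem st8_open {X : Type*} [t : TopologicalSpace X] (hX : DirSpace t)
    {K A : Set X} (hK : IsOpen K)
    (hA : ∀ m ∈ A, ∀ y ∈ K, specLE t y m → y = m) : IsOpen (K \ A) := by
  apply hX
  intro D hD x hx hconv
  by_contra hcon
  have hDA : ∀ e ∈ D, e ∈ K → e ∈ A := by
    intro e he heK
    by_contra h
    exact hcon ⟨e, he, heK, h⟩
  obtain ⟨d, hdD, hdK⟩ := hconv K hK hx.1
  have htop : ∀ e ∈ D, specLE t e d := by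
    intro e he
    obtain ⟨c, hc, hdc, hec⟩ := hD.2 d hdD e he
    have hcK := st8_up hK hdc hdK
    rw [hA c (hDA c hc hcK) d hdK hdc]
    exact hec
  have hxd : specLE t x d := by
    refine mem_closure_iff.2 fun U hU hxU => ?_
    obtain ⟨e, he, heU⟩ := hconv U hU hxU
    exact ⟨d, st8_up hU (htop e he) heU, rfl⟩
  have hxe := hA d (hDA d hdD hdK) x hx.1 hxd
  exact hx.2 (hxe ▸ hDA d hdD hdK)

theorem st8_main {X : Type*} [t : TopologicalSpace X] [T0Space X] (hX : DirSpace t)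
    (K : Set X) (hK : IsCompact K) (hKo : IsOpen K) :
    ∃ F : Set X, F.Finite ∧ K = upSet t F := by
  classical
  let M : Set X := {m | m ∈ K ∧ ∀ y ∈ K, specLE t y m → y = m}
  obtain ⟨F, hF⟩ := hK.elim_directed_cover (fun F : Finset X => K \ (M \ (F : Set X)))
    (fun F => st8_open hX hKo fun m hm => hm.1.2)
    (fun x hx => mem_iUnion.2 ⟨{x}, hx, fun h => h.2 (by simp)⟩)
    (by
      intro F G
      refine ⟨F ∪ G, ?_, ?_⟩ <;>
      · intro x hx
        refine ⟨hx.1, fun h => hx.2 ⟨h.1, fun h' => h.2 ?_⟩⟩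
        simp only [Finset.coe_union]
        first | exact Or.inl h' | exact Or.inr h')
  have hMF : M ⊆ F := fun m hm => by
    by_contra h
    exact (hF hm.1).2 ⟨hm, h⟩
  refine ⟨M, F.finite_toSet.subset hMF, ?_⟩
  ext x
  constructor
  · intro hx
    obtain ⟨m, hm, hmin, hle⟩ := st8_min hK hx
    exact ⟨m, ⟨hm, hmin⟩, hle⟩
  · rintro ⟨m, hm, hle⟩
    exact st8_up hKo hle hm.1

theorem st8_way {X : Type*} [t : TopologicalSpace X] (K : Opens X) :
    wayBelow K K ↔ IsCompact (K : Set X) := by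
  rw [← Opens.isCompactElement_iff, CompleteLattice.isCompactElement_iff_le_of_directed_sSup_le]
  rfl

theorem st8_compact {X : Type*} [t : TopologicalSpace X] {F : Set X} (hF : F.Finite) :
    IsCompact (upSet t F) := by
  refine isCompact_of_finite_subcover fun {ι} U hU hc => ?_
  obtain ⟨s, hs⟩ := hF.isCompact.elim_finite_subcover U hU
    (fun x hx => hc ⟨x, hx, subset_closure rfl⟩)
  refine ⟨s, ?_⟩
  rintro z ⟨a, ha, haz⟩
  exact st8_up (isOpen_biUnion fun i _ => hU i) haz (hs ha)

theorem statement8 {X : Type*} [t : TopologicalSpace X] [T0Space X] (hX : DirSpace t) :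
    (∀ K : Set X, IsCompact K → IsOpen K → ∃ F : Set X, F.Finite ∧ K = upSet t F) ∧
    (∀ K : Opens X, wayBelow K K → ∃ F : Set X, F.Finite ∧ (K : Set X) = upSet t F) ∧
    (AlgebraicLattice (Opens X) ↔
      ∀ U : Opens X,
        sSup {V : Opens X | (∃ F : Set X, F.Finite ∧ (V : Set X) = upSet t F) ∧ V ≤ U}
          = U) := by
  have h2 : ∀ K : Opens X, wayBelow K K ↔ ∃ F : Set X, F.Finite ∧ (K : Set X) = upSet t F := by
    intro K
    rw [st8_way]
    constructor
    · exact fun h => st8_main hX K h K.isOpen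
    · rintro ⟨F, hF, h⟩
      rw [h]
      exact st8_compact hF
  refine ⟨st8_main hX, fun K => (h2 K).1, ?_⟩
  simp only [AlgebraicLattice, h2]
end

section
/- Let X be a T0 topological space. Then X is a c-space if and only if the lattice C(X) of closed subsets of X is a continuous lattice, if and only if C(X) is a completely distributive lattice. -/
open Set TopologicalSpace

universe u

variable {X : Type*}

theorem mem_sSup_closeds {X : Type u} [TopologicalSpace X] (S : Set (Closeds X)) (x : X)
    (h : x ∈ sSup S) (U : Set X) (hU : IsOpen U) (hx : x ∈ U) : ∃ F ∈ S, ∃ y ∈ F, y ∈ U := by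
  by_contra hc
  push Not at hc
  have : sSup S ≤ (⟨Uᶜ, hU.isClosed_compl⟩ : Closeds X) :=
    sSup_le fun F hF y hy => hc F hF y hy
  exact this h hx

theorem cspace_cd {X : Type u} [t : TopologicalSpace X] (h : CSpace t) :
    CompletelyDistrib (Closeds X) := by
  intro ι κ f
  refine le_antisymm ?_ (iSup_le fun g => le_iInf fun i => le_trans (iInf_le (fun i => f i (g i)) i) (le_iSup (fun j => f i j) (g i)))
  intro x hx
  by_contra hc
  obtain ⟨y, hyU, hy⟩ := h x _ (Closeds.isClosed (⨆ g : (i : ι) → κ i, ⨅ i, f i (g i))).isOpen_compl hc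
  have key : ∀ i, ∃ j, y ∈ f i j := by
    intro i
    have hxi : x ∈ ⨆ j, f i j := (iInf_le (fun i => ⨆ j, f i j) i) hx
    obtain ⟨F, ⟨j, rfl⟩, z, hz, hzU⟩ := mem_sSup_closeds _ x hxi _ isOpen_interior hy
    obtain ⟨a, rfl, ha⟩ := interior_subset hzU
    exact ⟨j, closure_minimal (singleton_subset_iff.2 hz) (f i j).isClosed ha⟩
  choose g hg using key
  apply hyU
  apply le_iSup (fun g : (i : ι) → κ i => ⨅ i, f i (g i)) g
  have : Closeds.closure {y} ≤ ⨅ i, f i (g i) := le_iInf fun i =>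
    closure_minimal (singleton_subset_iff.2 (hg i)) (f i (g i)).isClosed
  exact this (subset_closure rfl)

theorem cd_cont {L : Type u} [CompleteLattice L] (h : CompletelyDistrib L) :
    ContinuousLattice L := by
  intro b
  refine ⟨⟨⊥, fun D ⟨d, hd⟩ _ _ => ⟨d, hd, bot_le⟩⟩, ?_, le_antisymm ?_ ?_⟩
  · intro a ha c hc
    refine ⟨a ⊔ c, ?_, le_sup_left, le_sup_right⟩
    intro D hD hd hb
    obtain ⟨d, hd1, h1⟩ := ha D hD hd hb
    obtain ⟨e, he1, h2⟩ := hc D hD hd hb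
    obtain ⟨k, hk, h3, h4⟩ := hd d hd1 e he1
    exact ⟨k, hk, sup_le (h1.trans h3) (h2.trans h4)⟩
  · apply sSup_le
    intro a ha
    obtain ⟨d, rfl, hd⟩ := ha {b} (singleton_nonempty b) (directedOn_singleton b) (by simp)
    exact hd
  · have := h {D : Set L // D.Nonempty ∧ DirectedOn (· ≤ ·) D ∧ b ≤ sSup D} (fun D => D.1)
      (fun D d => d.1)
    have h1 : b ≤ ⨅ D : {D : Set L // D.Nonempty ∧ DirectedOn (· ≤ ·) D ∧ b ≤ sSup D},
        ⨆ d : D.1, d.1 := le_iInf fun D => D.2.2.2.trans (sSup_eq_iSup' D.1).le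
    rw [this] at h1
    apply h1.trans
    apply iSup_le
    intro g
    apply le_sSup
    intro D hD hd hb
    exact ⟨_, (g ⟨D, hD, hd, hb⟩).2, iInf_le _ (⟨D, hD, hd, hb⟩ : {D : Set L // D.Nonempty ∧ DirectedOn (· ≤ ·) D ∧ b ≤ sSup D})⟩

theorem cont_cspace {X : Type u} [t : TopologicalSpace X]
    (h : ContinuousLattice (Closeds X)) : CSpace t := by
  intro x U hU hx
  obtain ⟨-, -, h3⟩ := h (Closeds.closure {x})
  have hx1 : x ∈ sSup {a | wayBelow a (Closeds.closure {x})} := by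
    rw [h3]; exact subset_closure rfl
  obtain ⟨A, hA, y, hyA, hyU⟩ := mem_sSup_closeds _ x hx1 U hU hx
  refine ⟨y, hyU, ?_⟩
  by_contra hc
  obtain ⟨F, hF, hAF⟩ := hA {F | y ∉ F} ⟨⊥, fun h => h⟩
    (fun F hF G hG => ⟨F ⊔ G, fun h => h.elim hF hG, le_sup_left, le_sup_right⟩) (by
      refine closure_minimal (singleton_subset_iff.2 ?_) (Closeds.isClosed _)
      by_contra hn
      apply hc
      refine mem_interior.2 ⟨_, ?_, (Closeds.isClosed _).isOpen_compl, hn⟩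
      intro z hz
      by_contra hyz
      apply hz
      have : Closeds.closure {z} ≤ sSup {F : Closeds X | y ∉ F} :=
        le_sSup fun hy => hyz ⟨y, rfl, hy⟩
      exact this (subset_closure rfl))
  exact hF (hAF hyA)

theorem statement9 {X : Type u} [t : TopologicalSpace X] [T0Space X] :
    (CSpace t ↔ ContinuousLattice (Closeds X)) ∧
    (CSpace t ↔ CompletelyDistrib (Closeds X)) :=
  ⟨⟨fun h => cd_cont (cspace_cd h), cont_cspace⟩,
    ⟨cspace_cd, fun h => cont_cspace (cd_cont h)⟩⟩
end

section
/- Let X be a T0 topological space. Then X is locally hypercompact if and only if the lattice C(X) of closed subsets of X is a quasicontinuous lattice. -/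
open Set TopologicalSpace

universe u

variable {X : Type*}

theorem statement10 {X : Type*} [t : TopologicalSpace X] [T0Space X] :
    LocallyHypercompact t ↔ QuasicontinuousLattice (Closeds X) := by
  constructor
  · intro h A
    refine ⟨?_, ?_⟩
    · intro F G hF hFA hG hGA
      refine ⟨Set.image2 (· ⊔ ·) F G, hF.image2 _ hG, ?_, ?_, ?_⟩
      · intro D hne hD hA
        obtain ⟨d1, hd1, f, hf, hfd⟩ := hFA D hne hD hA
        obtain ⟨d2, hd2, g, hg, hgd⟩ := hGA D hne hD hA
        obtain ⟨d, hd, h1, h2⟩ := hD d1 hd1 d2 hd2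
        exact ⟨d, hd, f ⊔ g, ⟨f, hf, g, hg, rfl⟩, sup_le (hfd.trans h1) (hgd.trans h2)⟩
      · rintro z ⟨_, ⟨f, hf, g, hg, rfl⟩, hz⟩
        exact ⟨f, hf, le_sup_left.trans hz⟩
      · rintro z ⟨_, ⟨f, hf, g, hg, rfl⟩, hz⟩
        exact ⟨g, hg, le_sup_right.trans hz⟩
    · apply Set.Subset.antisymm
      · rintro B hB _ ⟨F, hF, hFA, rfl⟩
        obtain ⟨d, hd, f, hf, hfd⟩ := hFA {A} ⟨A, rfl⟩
          (by rintro a rfl b rfl; exact ⟨_, rfl, le_rfl, le_rfl⟩) (by simp)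
        rw [Set.mem_singleton_iff] at hd
        subst hd
        exact ⟨f, hf, hfd.trans hB⟩
      · intro B hB
        by_contra hAB
        have hAB' : ¬ ((A : Set X) ⊆ (B : Set X)) := hAB
        obtain ⟨x, hxA, hxB⟩ := Set.not_subset.1 hAB'
        obtain ⟨F, hF, hxF, hFU⟩ := h (B : Set X)ᶜ B.isClosed.isOpen_compl x hxB
        obtain ⟨_, ⟨a, ha, rfl⟩, haB⟩ := hB _ ⟨(fun a => Closeds.closure {a}) '' F, hF.image _, (by
          intro D hne hD hA
          have hx : x ∈ closure (⋃ d ∈ D, (d : Set X)) := by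
            have hle : sSup D ≤ Closeds.closure (⋃ d ∈ D, (d : Set X)) := by
              refine sSup_le fun d hd => ?_
              have : (d : Set X) ⊆ closure (⋃ d ∈ D, (d : Set X)) :=
                (Set.subset_biUnion_of_mem (u := fun d : Closeds X => (d : Set X)) hd).trans
                  subset_closure
              exact this
            exact hle (hA hxA)
          obtain ⟨z, hz, hzD⟩ := mem_closure_iff.1 hx _ isOpen_interior hxF
          obtain ⟨d, hd, hzd⟩ := Set.mem_iUnion₂.1 hzD
          obtain ⟨a, ha, haz⟩ := interior_subset hz
          refine ⟨d, hd, _, ⟨a, ha, rfl⟩, ?_⟩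
          have had : a ∈ (d : Set X) :=
            closure_minimal (Set.singleton_subset_iff.2 hzd) d.isClosed haz
          have : closure {a} ⊆ (d : Set X) :=
            closure_minimal (Set.singleton_subset_iff.2 had) d.isClosed
          exact this), rfl⟩
        have haa : a ∈ closure ({a} : Set X) := subset_closure rfl
        exact hFU ⟨a, ha, haa⟩ (haB haa)
  · intro h U hU x hxU
    let B : Closeds X := ⟨Uᶜ, IsOpen.isClosed_compl hU⟩
    have hB : B ∉ Set.Ici (Closeds.closure {x}) := by
      intro hB
      have : x ∈ closure ({x} : Set X) := subset_closure rfl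
      exact (hB this : x ∈ Uᶜ) hxU
    rw [(h (Closeds.closure {x})).2] at hB
    simp only [Set.mem_sInter, Set.mem_setOf_eq, not_forall] at hB
    obtain ⟨_, ⟨F, hF, hFx, rfl⟩, hBF⟩ := hB
    have key : ∀ f : Closeds X, ∃ a : X, f ∈ F → a ∈ f ∧ a ∈ U := by
      intro f
      by_cases hf : f ∈ F
      · have : ¬ ((f : Set X) ⊆ Uᶜ) := fun hs => hBF ⟨f, hf, hs⟩
        obtain ⟨a, ha, haU⟩ := Set.not_subset.1 this
        exact ⟨a, fun _ => ⟨ha, not_not.1 haU⟩⟩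
      · exact ⟨x, fun h => absurd h hf⟩
    choose a ha using key
    refine ⟨a '' F, hF.image _, ?_, ?_⟩
    · by_contra hx
      have hx' : x ∈ closure (upSet t (a '' F))ᶜ := by
        rw [closure_compl]; exact hx
      obtain ⟨_, ⟨E, ⟨hE, hEs⟩, rfl⟩, f, hf, hfE⟩ := hFx
        ((fun E : Set X => Closeds.closure E) '' {E | E.Finite ∧ E ⊆ (upSet t (a '' F))ᶜ})
        ⟨_, ∅, ⟨Set.finite_empty, Set.empty_subset _⟩, rfl⟩
        (by
          rintro _ ⟨E, ⟨hE, hEs⟩, rfl⟩ _ ⟨E', ⟨hE', hEs'⟩, rfl⟩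
          refine ⟨_, ⟨E ∪ E', ⟨hE.union hE', Set.union_subset hEs hEs'⟩, rfl⟩, ?_, ?_⟩
          · exact closure_mono (s := E) (t := E ∪ E') Set.subset_union_left
          · exact closure_mono (s := E') (t := E ∪ E') Set.subset_union_right)
        (by
          set S := sSup ((fun E : Set X => Closeds.closure E) ''
            {E | E.Finite ∧ E ⊆ (upSet t (a '' F))ᶜ}) with hS
          have hsub : (upSet t (a '' F))ᶜ ⊆ (S : Set X) := by
            intro y hy
            have hle : Closeds.closure {y} ≤ S :=
              le_sSup ⟨{y}, ⟨Set.finite_singleton y, Set.singleton_subset_iff.2 hy⟩, rfl⟩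
            have : y ∈ closure ({y} : Set X) := subset_closure rfl
            exact hle this
          have hxS : x ∈ (S : Set X) := closure_minimal hsub S.isClosed hx'
          have : closure {x} ⊆ (S : Set X) :=
            closure_minimal (Set.singleton_subset_iff.2 hxS) S.isClosed
          exact this)
      have h1 : a f ∈ closure E := hfE (ha f hf).1
      rw [← Set.biUnion_of_singleton E, hE.closure_biUnion] at h1
      obtain ⟨e, he, hae⟩ := Set.mem_iUnion₂.1 h1
      exact hEs he ⟨a f, ⟨f, hf, rfl⟩, hae⟩
    · rintro z ⟨_, ⟨f, hf, rfl⟩, hz⟩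
      obtain ⟨w, hw, hw'⟩ := mem_closure_iff.1 hz U hU (ha f hf).2
      rw [Set.mem_singleton_iff] at hw'
      exact hw' ▸ hw
end

section
/- Let X be a T0 topological space. Then X is a b-space if and only if the lattice C(X) of closed subsets of X is an algebraic lattice. -/
open Set TopologicalSpace

universe u

variable {X : Type*}

theorem aux_wb_fin {L : Type*} [CompleteLattice L] {k : L} (hk : wayBelow k k) (s : Set L)
    (h : k ≤ sSup s) : ∃ t : Finset L, ↑t ⊆ s ∧ k ≤ t.sup id := by
  have : IsCompactElement k := by
    rw [CompleteLattice.isCompactElement_iff_le_of_directed_sSup_le]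
    exact hk
  rw [CompleteLattice.isCompactElement_iff_exists_le_sSup_of_le_sSup] at this
  exact this s h

theorem aux_mem_fin {X : Type*} [TopologicalSpace X] {F : Finset (Closeds X)} {x : X}
    (h : x ∈ F.sup id) : ∃ c ∈ F, x ∈ c := by
  have h' : x ∈ ((F.sup id : Closeds X) : Set X) := h
  rw [Closeds.coe_finset_sup] at h'
  simpa using h'

theorem aux_mem_up {X : Type*} [t : TopologicalSpace X] {y z : X} :
    z ∈ upSet t {y} ↔ y ∈ closure ({z} : Set X) := by
  simp [upSet, specLE]

theorem aux_mem_open {X : Type*} [t : TopologicalSpace X] {y z : X} {U : Set X}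
    (hU : IsOpen U) (hy : y ∈ U) (h : y ∈ closure ({z} : Set X)) : z ∈ U := by
  obtain ⟨w, hw, rfl⟩ := mem_closure_iff.1 h U hU hy
  exact hw

theorem aux_cl_le {X : Type*} [t : TopologicalSpace X] {y : X} {C : Closeds X} :
    Closeds.closure {y} ≤ C ↔ y ∈ C := by
  rw [Closeds.gc.le_iff_le]
  simp

theorem aux_open {X : Type*} [t : TopologicalSpace X] {y : X}
    (h : wayBelow (Closeds.closure ({y} : Set X)) (Closeds.closure {y})) :
    IsOpen (upSet t {y}) := by
  have key : y ∉ closure (upSet t {y})ᶜ := by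
    intro hy
    obtain ⟨F, hF, hle⟩ := aux_wb_fin h
      ((fun z : X => Closeds.closure ({z} : Set X)) '' (upSet t {y})ᶜ) (by
        rw [aux_cl_le]
        have : closure (upSet t {y})ᶜ ⊆
            ((sSup ((fun z : X => Closeds.closure ({z} : Set X)) '' (upSet t {y})ᶜ) :
              Closeds X) : Set X) := by
          apply closure_minimal _ (Closeds.isClosed _)
          intro z hz
          exact aux_cl_le.1 (le_sSup (mem_image_of_mem _ hz))
        exact this hy)
    obtain ⟨c, hc, hyc⟩ := aux_mem_fin (aux_cl_le.1 hle)
    obtain ⟨z, hz, rfl⟩ := hF hc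
    exact hz (aux_mem_up.2 hyc)
  have : IsClosed (upSet t {y})ᶜ := by
    apply isClosed_of_closure_subset
    intro z hz hzy
    apply key
    exact closure_minimal (singleton_subset_iff.2 hz) isClosed_closure (aux_mem_up.1 hzy)
  simpa using this.isOpen_compl

theorem aux_compact {X : Type*} [t : TopologicalSpace X] {y : X}
    (h : IsOpen (upSet t {y})) :
    wayBelow (Closeds.closure ({y} : Set X)) (Closeds.closure {y}) := by
  intro D _ _ hle
  rw [aux_cl_le] at hle
  have hle' : y ∈ ((sSup D : Closeds X) : Set X) := hle
  rw [Closeds.coe_sSup] at hle'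
  obtain ⟨z, hz, hzD⟩ := mem_closure_iff.1 hle' _ h (aux_mem_up.2 (subset_closure rfl))
  obtain ⟨_, ⟨d, hd, rfl⟩, hzd⟩ := hzD
  exact ⟨d, hd, aux_cl_le.2 (aux_cl_le.2 hzd (aux_mem_up.1 hz))⟩

theorem aux_finite {X : Type*} [t : TopologicalSpace X] {K : Closeds X} (hK : wayBelow K K) :
    ∃ F : Finset X, Closeds.closure (F : Set X) = K := by
  classical
  obtain ⟨T, hT, hle⟩ := aux_wb_fin hK
    ((fun z : X => Closeds.closure ({z} : Set X)) '' (K : Set X)) (by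
      intro x hx
      exact aux_cl_le.1 (le_sSup (mem_image_of_mem _ hx)))
  obtain ⟨F, hF, rfl⟩ := Finset.subset_set_image_iff.1 hT
  refine ⟨F, le_antisymm (Closeds.gc.l_le hF) (hle.trans ?_)⟩
  apply Finset.sup_le
  intro c hc
  obtain ⟨z, hz, rfl⟩ := Finset.mem_image.1 hc
  exact aux_cl_le.2 (subset_closure hz)

theorem aux_principal {X : Type*} [t : TopologicalSpace X]
    (hA : AlgebraicLattice (Closeds X)) {K : Closeds X} (hK : wayBelow K K) :
    ∃ F : Finset X, Closeds.closure (F : Set X) = K ∧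
      ∀ f ∈ F, wayBelow (Closeds.closure ({f} : Set X)) (Closeds.closure {f}) := by
  classical
  obtain ⟨F, hF, hmin⟩ := WellFounded.has_min (wellFounded_lt (α := Finset X))
    {F : Finset X | Closeds.closure (F : Set X) = K} (aux_finite hK)
  refine ⟨F, hF, fun f hf => ?_⟩
  have hF' : Closeds.closure (F : Set X) = K := hF
  obtain ⟨T, hT, hle⟩ := aux_wb_fin hK
    (insert (Closeds.closure ((F.erase f : Finset X) : Set X))
      {k | wayBelow k k ∧ k ≤ Closeds.closure {f}}) (by
      rw [sSup_insert, hA, ← hF', Closeds.gc.le_iff_le]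
      intro z hz
      by_cases hzf : z = f
      · subst hzf
        exact (le_sup_right : _ ≤ Closeds.closure ((F.erase z : Finset X) : Set X) ⊔ _)
          (subset_closure rfl)
      · exact (le_sup_left : _ ≤ _ ⊔ Closeds.closure {f})
          (subset_closure (Finset.mem_coe.2 (Finset.mem_erase.2 ⟨hzf, hz⟩))))
  have hfK : f ∈ K := by
    rw [← hF']; exact subset_closure hf
  obtain ⟨c, hc, hfc⟩ := aux_mem_fin (hle hfK)
  rcases hT hc with rfl | ⟨hc1, hc2⟩
  · exfalso
    refine hmin (F.erase f) ?_ (Finset.erase_ssubset hf)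
    show Closeds.closure _ = K
    rw [← hF']
    apply le_antisymm
    · exact Closeds.gc.monotone_l (Finset.coe_subset.2 (Finset.erase_subset _ _))
    · rw [Closeds.gc.le_iff_le]
      intro z hz
      by_cases hzf : z = f
      · subst hzf; exact hfc
      · exact subset_closure (Finset.mem_coe.2 (Finset.mem_erase.2 ⟨hzf, hz⟩))
  · rwa [← le_antisymm hc2 (aux_cl_le.2 hfc)]

theorem statement11 {X : Type*} [t : TopologicalSpace X] [T0Space X] :
    BSpace t ↔ AlgebraicLattice (Closeds X) := by
  constructor
  · intro hB C
    apply le_antisymm (sSup_le fun k hk => hk.2)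
    intro x hx
    by_contra hn
    obtain ⟨y, hy, hyo, hxy, -⟩ := hB x
      ((sSup {k : Closeds X | wayBelow k k ∧ k ≤ C} : Closeds X) : Set X)ᶜ
      (Closeds.isClosed _).isOpen_compl hn
    apply hy
    refine aux_cl_le.1 (le_sSup ⟨aux_compact hyo, ?_⟩)
    exact aux_cl_le.2 (aux_cl_le.2 hx (aux_mem_up.1 hxy))
  · intro hA x U hU hxU
    have hx : x ∈ ((sSup {k : Closeds X | wayBelow k k ∧ k ≤ Closeds.closure {x}} :
        Closeds X) : Set X) := by
      rw [hA]; exact subset_closure rfl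
    rw [Closeds.coe_sSup] at hx
    obtain ⟨z, hzU, hz⟩ := mem_closure_iff.1 hx U hU hxU
    obtain ⟨_, ⟨K, ⟨hK, hKx⟩, rfl⟩, hzK⟩ := hz
    obtain ⟨F, hF, hFc⟩ := aux_principal hA hK
    rw [← hF] at hzK
    obtain ⟨y, hyU, hyF⟩ := mem_closure_iff.1 hzK U hU hzU
    refine ⟨y, hyU, aux_open (hFc y hyF), aux_mem_up.2 (hKx ?_), fun w hw =>
      aux_mem_open hU hyU (aux_mem_up.1 hw)⟩
    rw [← hF]; exact subset_closure hyF
end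

section
/- Let X and Y be directed spaces. A subset W of X × Y is open in D(X × Y) (the space X × Y retopologized with the directed-open sets of the product topology) if and only if for every (x,y) ∈ X × Y the slices W_x = {y' ∈ Y : (x,y') ∈ W} and W^y = {x' ∈ X : (x',y) ∈ W} are open in Y and in X respectively. -/
open Set TopologicalSpace

universe u

variable {X : Type*}

theorem statement12 {X Y : Type*} [tX : TopologicalSpace X] [tY : TopologicalSpace Y]
    [T0Space X] [T0Space Y] (hX : DirSpace tX) (hY : DirSpace tY) (W : Set (X × Y)) :
    DirOpen (inferInstance : TopologicalSpace (X × Y)) W ↔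
      ((∀ x : X, IsOpen {y' : Y | (x, y') ∈ W}) ∧
       (∀ y : Y, IsOpen {x' : X | (x', y) ∈ W})) := by
  have sp : ∀ {Z : Type _} [t : TopologicalSpace Z] (a b : Z), specLE t a b ↔ b ⤳ a := by
    intro Z t a b
    exact specializes_iff_mem_closure.symm
  have spY : ∀ {Z : Type _} [t : TopologicalSpace Z] (a b : Z), specLE t a b ↔ b ⤳ a := by
    intro Z t a b
    exact specializes_iff_mem_closure.symm
  have spP : ∀ (a b : X × Y), specLE inferInstance a b ↔ b ⤳ a := by
    intro a b
    exact specializes_iff_mem_closure.symm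
  constructor
  · intro h
    constructor
    · intro x
      apply hY
      intro D hD y hy hc
      have hdir : DirSet (inferInstance : TopologicalSpace (X × Y)) (Set.image (fun y' => (x, y')) D) := by
        refine ⟨hD.1.image _, ?_⟩
        rintro _ ⟨a, ha, rfl⟩ _ ⟨b, hb, rfl⟩
        obtain ⟨c, hc, h1, h2⟩ := hD.2 a ha b hb
        refine ⟨(x, c), ⟨c, hc, rfl⟩, ?_, ?_⟩
        · exact (spP _ _).2 (specializes_rfl.prod ((spY _ _).1 h1))
        · exact (spP _ _).2 (specializes_rfl.prod ((spY _ _).1 h2))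
      have hcv : DConv (inferInstance : TopologicalSpace (X × Y))
          (Set.image (fun y' => (x, y')) D) (x, y) := by
        intro U hU hxU
        have hU' : IsOpen U := hU
        obtain ⟨d, hd, hdU⟩ := hc ((fun y' => (x, y')) ⁻¹' U)
          (hU'.preimage (by fun_prop)) hxU
        exact ⟨(x, d), ⟨d, hd, rfl⟩, hdU⟩
      obtain ⟨_, ⟨d, hd, rfl⟩, hdW⟩ := h _ hdir (x, y) hy hcv
      exact ⟨d, hd, hdW⟩
    · intro y
      apply hX
      intro D hD x hx hc
      have hdir : DirSet (inferInstance : TopologicalSpace (X × Y)) (Set.image (fun x' => (x', y)) D) := by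
        refine ⟨hD.1.image _, ?_⟩
        rintro _ ⟨a, ha, rfl⟩ _ ⟨b, hb, rfl⟩
        obtain ⟨c, hc, h1, h2⟩ := hD.2 a ha b hb
        refine ⟨(c, y), ⟨c, hc, rfl⟩, ?_, ?_⟩
        · exact (spP _ _).2 (((sp _ _).1 h1).prod specializes_rfl)
        · exact (spP _ _).2 (((sp _ _).1 h2).prod specializes_rfl)
      have hcv : DConv (inferInstance : TopologicalSpace (X × Y))
          (Set.image (fun x' => (x', y)) D) (x, y) := by
        intro U hU hxU
        have hU' : IsOpen U := hU
        obtain ⟨d, hd, hdU⟩ := hc ((fun x' => (x', y)) ⁻¹' U)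
          (hU'.preimage (by fun_prop)) hxU
        exact ⟨(d, y), ⟨d, hd, rfl⟩, hdU⟩
      obtain ⟨_, ⟨d, hd, rfl⟩, hdW⟩ := h _ hdir (x, y) hx hcv
      exact ⟨d, hd, hdW⟩
  · rintro ⟨h1, h2⟩ D hD ⟨x, y⟩ hW hc
    obtain ⟨⟨a, b⟩, hab, haW⟩ := hc (Prod.fst ⁻¹' {x' : X | (x', y) ∈ W})
      ((h2 y).preimage continuous_fst) hW
    obtain ⟨⟨a', b'⟩, hab', hbW⟩ := hc (Prod.snd ⁻¹' {y' : Y | (a, y') ∈ W})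
      ((h1 a).preimage continuous_snd) haW
    obtain ⟨⟨c, d⟩, hcD, hl, hr⟩ := hD.2 _ hab _ hab'
    have hl' : c ⤳ a := ((spP _ _).1 hl).fst
    have hr' : d ⤳ b' := ((spP _ _).1 hr).snd
    have e1 : (c, b') ∈ W := hl'.mem_open (h2 b') hbW
    exact ⟨(c, d), hcD, hr'.mem_open (h1 c) e1⟩
end

section
/- Let X, Y, Z be directed spaces. A map f : X × Y → Z is continuous from D(X × Y) to Z if and only if f is separately continuous, i.e., for every x ∈ X the map y ↦ f(x,y) is continuous from Y to Z and for every y ∈ Y the map x ↦ f(x,y) is continuous from X to Z. -/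
open Set TopologicalSpace

universe u

variable {X : Type*}

theorem statement13 {X Y Z : Type*} [tX : TopologicalSpace X] [tY : TopologicalSpace Y]
    [tZ : TopologicalSpace Z] [T0Space X] [T0Space Y] [T0Space Z]
    (hX : DirSpace tX) (hY : DirSpace tY) (hZ : DirSpace tZ) (f : X × Y → Z) :
    (∀ V : Set Z, IsOpen V → DirOpen (inferInstance : TopologicalSpace (X × Y)) (f ⁻¹' V)) ↔
      ((∀ x : X, Continuous fun y : Y => f (x, y)) ∧
       (∀ y : Y, Continuous fun x : X => f (x, y))) := by
  constructor
  · intro h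
    refine ⟨fun x => ⟨fun V hV => hY _ ?_⟩, fun y => ⟨fun V hV => hX _ ?_⟩⟩
    · intro D hD y hy hc
      obtain ⟨p, ⟨d, hd, rfl⟩, hp⟩ := h V hV ((fun y' => (x, y')) '' D) ⟨hD.1.image _, by
        rintro _ ⟨a, ha, rfl⟩ _ ⟨b, hb, rfl⟩
        obtain ⟨c, hc, h1, h2⟩ := hD.2 a ha b hb
        exact ⟨_, ⟨c, hc, rfl⟩,
          specializes_iff_mem_closure.1
            ((specializes_refl x).prod (specializes_iff_mem_closure.2 h1)),
          specializes_iff_mem_closure.1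
            ((specializes_refl x).prod (specializes_iff_mem_closure.2 h2))⟩⟩ (x, y) hy (by
        intro U hU hm
        have hU' : IsOpen ((fun y' => (x, y')) ⁻¹' U) :=
          IsOpen.preimage (by fun_prop) hU
        obtain ⟨d, hd, hdU⟩ := hc _ hU' hm
        exact ⟨_, ⟨d, hd, rfl⟩, hdU⟩)
      exact ⟨d, hd, hp⟩
    · intro D hD x hx hc
      obtain ⟨p, ⟨d, hd, rfl⟩, hp⟩ := h V hV ((fun x' => (x', y)) '' D) ⟨hD.1.image _, by
        rintro _ ⟨a, ha, rfl⟩ _ ⟨b, hb, rfl⟩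
        obtain ⟨c, hc, h1, h2⟩ := hD.2 a ha b hb
        exact ⟨_, ⟨c, hc, rfl⟩,
          specializes_iff_mem_closure.1
            ((specializes_iff_mem_closure.2 h1).prod (specializes_refl y)),
          specializes_iff_mem_closure.1
            ((specializes_iff_mem_closure.2 h2).prod (specializes_refl y))⟩⟩ (x, y) hx (by
        intro U hU hm
        have hU' : IsOpen ((fun x' => (x', y)) ⁻¹' U) :=
          IsOpen.preimage (by fun_prop) hU
        obtain ⟨d, hd, hdU⟩ := hc _ hU' hm
        exact ⟨_, ⟨d, hd, rfl⟩, hdU⟩)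
      exact ⟨d, hd, hp⟩
  · rintro ⟨h1, h2⟩ V hV D hD ⟨x, y⟩ hxy hc
    have o1 : ∀ x, IsOpen {y | f (x, y) ∈ V} := fun x => hV.preimage (h1 x)
    have o2 : ∀ y, IsOpen {x | f (x, y) ∈ V} := fun y => hV.preimage (h2 y)
    obtain ⟨⟨a, b⟩, hab, ha⟩ := hc _ ((o2 y).preimage continuous_fst) hxy
    obtain ⟨⟨c, d⟩, hcd, hd⟩ := hc _ ((o1 a).preimage continuous_snd) ha
    obtain ⟨⟨e, g⟩, heg, s1, s2⟩ := hD.2 _ hab _ hcd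
    have t1 : e ⤳ a := (specializes_iff_mem_closure.2 s1).map continuous_fst
    have t2 : g ⤳ d := (specializes_iff_mem_closure.2 s2).map continuous_snd
    have k1 : f (e, d) ∈ V := t1.mem_open (o2 d) hd
    have k2 : f (e, g) ∈ V := t2.mem_open (o1 e) k1
    exact ⟨(e, g), heg, k2⟩
end

section
/- Let X be a topological space. The Scott topology on the lattice C(X) of closed subsets of X equals the upper topology on C(X) if and only if for every n ≥ 1 the map s_n : Xⁿ → Σ C(X) defined by s_n(x_1, …, x_n) = cl({x_1, …, x_n}) (the closure of the finite set, equivalently ↓{x_1,…,x_n}) is continuous, where Xⁿ carries the product topology and Σ C(X) is C(X) with the Scott topology. -/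
open Set TopologicalSpace

universe u

variable {X : Type*}

noncomputable instance {X : Type*} [TopologicalSpace X] : TopologicalSpace (Closeds X) :=
  scottSp (Closeds X)

theorem scottOpen_compl_Iic_s15 {L : Type*} [Preorder L] (a : L) :
    ScottOpen ((Set.Iic a)ᶜ) := by
  refine ⟨(isLowerSet_Iic a).compl, fun D _ _ s hs hsa => ?_⟩
  by_contra hne
  apply hsa
  refine hs.2 fun d hd => ?_
  by_contra hda
  exact hne ⟨d, hd, hda⟩

theorem scott_le_upper_s15 {L : Type*} [Preorder L] : scottSp L ≤ upperSp L := by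
  refine le_generateFrom ?_
  rintro _ ⟨a, rfl⟩
  exact isOpen_generateFrom_of_mem (scottOpen_compl_Iic_s15 a)

theorem continuous_upper_s15 {X : Type*} [TopologicalSpace X] (n : ℕ) :
    @Continuous _ _ _ (upperSp (Closeds X)) (fun x : Fin n → X =>
      (⟨closure (Set.range x), isClosed_closure⟩ : Closeds X)) := by
  refine continuous_generateFrom_iff.2 ?_
  rintro _ ⟨A, rfl⟩
  have : ((fun x : Fin n → X =>
      (⟨closure (Set.range x), isClosed_closure⟩ : Closeds X)) ⁻¹' (Set.Iic A)ᶜ)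
      = ⋃ i, (fun x : Fin n → X => x i) ⁻¹' (A : Set X)ᶜ := by
    ext x
    have : (⟨closure (Set.range x), isClosed_closure⟩ : Closeds X) ≤ A ↔ ∀ i, x i ∈ A := by
      rw [← SetLike.coe_subset_coe, Closeds.coe_mk, A.isClosed.closure_subset_iff,
        Set.range_subset_iff]
      rfl
    simp [this]
  rw [this]
  exact isOpen_iUnion fun i => A.isClosed.isOpen_compl.preimage (continuous_apply i)

theorem upper_open_s15 {X : Type*} [TopologicalSpace X] {U : Set (Closeds X)} (hU : ScottOpen U)
    (h : ∀ n : ℕ, 1 ≤ n → IsOpen ((fun x : Fin n → X =>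
      (⟨closure (Set.range x), isClosed_closure⟩ : Closeds X)) ⁻¹' U)) :
    @IsOpen _ (upperSp (Closeds X)) U := by
  letI : TopologicalSpace (Closeds X) := upperSp (Closeds X)
  rw [isOpen_iff_mem_nhds]
  intro C hC
  let D : Set (Closeds X) := {K | ∃ F : Set X, F.Finite ∧ F ⊆ C ∧ K = Closeds.closure F}
  have hD : (D ∩ U).Nonempty := by
    refine hU.2 D ⟨_, ∅, Set.finite_empty, Set.empty_subset _, rfl⟩ ?_ C ⟨?_, ?_⟩ hC
    · rintro _ ⟨F, hF, hFC, rfl⟩ _ ⟨G, hG, hGC, rfl⟩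
      exact ⟨_, ⟨F ∪ G, hF.union hG, Set.union_subset hFC hGC, rfl⟩,
        Closeds.gc.monotone_l Set.subset_union_left, Closeds.gc.monotone_l Set.subset_union_right⟩
    · rintro _ ⟨F, hF, hFC, rfl⟩
      exact Closeds.closure_le.2 hFC
    · intro B hB x hx
      have := hB ⟨{x}, Set.finite_singleton x, by simpa using hx, rfl⟩
      exact Closeds.closure_le.1 this rfl
  obtain ⟨_, ⟨F, hF, hFC, rfl⟩, hFU⟩ := hD
  obtain ⟨n, x, rfl⟩ : ∃ (n : ℕ) (x : Fin n → X), Set.range x = F := by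
    have := hF.to_subtype
    obtain ⟨n, ⟨e⟩⟩ := Finite.exists_equiv_fin F
    exact ⟨n, fun i => (e.symm i : X), by
      rw [show (fun i => (e.symm i : X)) = Subtype.val ∘ e.symm from rfl, Set.range_comp]
      simp⟩
  rcases Nat.eq_zero_or_pos n with rfl | hn
  · refine Filter.mem_of_superset Filter.univ_mem fun K _ => hU.1 ?_ hFU
    exact Closeds.closure_le.2 (by simp)
  have hx : x ∈ (fun x : Fin n → X =>
      (⟨closure (Set.range x), isClosed_closure⟩ : Closeds X)) ⁻¹' U := hFU
  obtain ⟨V, hV, hVU⟩ := isOpen_pi_iff'.1 (h n hn) x hx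
  have key : (⋂ i, {K : Closeds X | ((K : Set X) ∩ V i).Nonempty}) ∈ nhds C := by
    rw [Filter.iInter_mem]
    intro i
    refine IsOpen.mem_nhds ?_ ⟨x i, hFC ⟨i, rfl⟩, (hV i).2⟩
    refine isOpen_generateFrom_of_mem ⟨⟨(V i)ᶜ, (hV i).1.isClosed_compl⟩, ?_⟩
    ext K
    change _ ↔ ¬ ((K : Set X) ⊆ (V i)ᶜ)
    rw [Set.subset_compl_iff_disjoint_right, Set.not_disjoint_iff_nonempty_inter]
    rfl
  refine Filter.mem_of_superset key fun K hK => ?_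
  choose y hy using Set.mem_iInter.1 hK
  refine hU.1 ?_ (hVU (a := y) fun i _ => (hy i).2)
  exact Closeds.closure_le.2 (Set.range_subset_iff.2 fun i => (hy i).1)

theorem statement15 {X : Type*} [t : TopologicalSpace X] :
    scottSp (Closeds X) = upperSp (Closeds X) ↔
      ∀ n : ℕ, 1 ≤ n →
        Continuous (fun x : Fin n → X =>
          (⟨closure (Set.range x), isClosed_closure⟩ : Closeds X)) := by
  constructor
  · intro h n _
    refine @Continuous.mk _ _ _ _ _ ?_
    intro U hU
    have hU' : @IsOpen _ (scottSp (Closeds X)) U := hU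
    rw [h] at hU'
    have hc := continuous_upper_s15 (X := X) n
    exact @Continuous.isOpen_preimage _ _ _ (upperSp (Closeds X)) _ hc U hU'
  · intro h
    apply le_antisymm
    · exact scott_le_upper_s15
    · refine le_generateFrom ?_
      intro U hU
      refine upper_open_s15 hU fun n hn => ?_
      exact (h n hn).isOpen_preimage U (isOpen_generateFrom_of_mem hU)
end
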